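/- (Associativity of the loss.) For all LTL_f formulas ρ₁, ρ₂, ρ₃, every trace T, every time index t, and every γ ∈ ℝ: L(ρ₁ ∧ (ρ₂ ∧ ρ₃), T, t, γ) = L((ρ₁ ∧ ρ₂) ∧ ρ₃, T, t, γ) and L(ρ₁ ∨ (ρ₂ ∨ ρ₃), T, t, γ) = L((ρ₁ ∨ ρ₂) ∨ ρ₃, T, t, γ). -/

import Mathlib

/-- LTL_f formulas over real-valued traces. Atoms compare state components
indexed by natural numbers. -/
inductive Formula : Type where
  | leq : ℕ → ℕ → Formula          -- φ₁ ≤ φ₂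
  | lt : ℕ → ℕ → Formula           -- φ₁ < φ₂
  | eq : ℕ → ℕ → Formula           -- φ₁ = φ₂
  | neq : ℕ → ℕ → Formula          -- φ₁ ≠ φ₂
  | conj : Formula → Formula → Formula
  | disj : Formula → Formula → Formula
  | snext : Formula → Formula      -- 𝒩 (Strong Next)
  | wnext : Formula → Formula      -- 𝒳 (Weak Next)
  | always : Formula → Formula     -- □
  | eventually : Formula → Formula -- ◇
  | wuntil : Formula → Formula → Formula   -- 𝒰 (Weak Until)
  | srelease : Formula → Formula → Formula -- ℛ (Strong Release)

/-- Smooth maximum: `max γ a b`. -/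
noncomputable def smax (γ a b : ℝ) : ℝ :=
  if γ ≤ 0 then max a b else γ * Real.log (Real.exp (a / γ) + Real.exp (b / γ))

/-- Smooth minimum: `min γ a b`. -/
noncomputable def smin (γ a b : ℝ) : ℝ :=
  if γ ≤ 0 then min a b else -γ * Real.log (Real.exp (-a / γ) + Real.exp (-b / γ))

/-- Smooth Gaussian: `Gaussian γ a`. -/
noncomputable def sgauss (γ a : ℝ) : ℝ :=
  if γ ≤ 0 then (if a = 0 then 1 else 0) else Real.exp (-(a ^ 2) / (2 * γ ^ 2))

/-- A weight on formulas, used as a termination measure for the recursion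
defining the loss (the clauses for `<` and `=` recurse into the clauses
for `≤` and `≠` at the same time step). -/
def Formula.weight : Formula → ℕ
  | .leq _ _ => 1
  | .neq _ _ => 1
  | .lt _ _ => 2
  | .eq _ _ => 2
  | .conj ρ₁ ρ₂ => ρ₁.weight + ρ₂.weight + 1
  | .disj ρ₁ ρ₂ => ρ₁.weight + ρ₂.weight + 1
  | .snext ρ => ρ.weight + 1
  | .wnext ρ => ρ.weight + 1
  | .always ρ => ρ.weight + 1
  | .eventually ρ => ρ.weight + 1
  | .wuntil ρ₁ ρ₂ => ρ₁.weight + ρ₂.weight + 1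
  | .srelease ρ₁ ρ₂ => ρ₁.weight + ρ₂.weight + 1


/-- The loss function L(ρ,T,t,γ) over a trace of length `d`. -/
noncomputable def L (d : ℕ) (T : ℕ → ℕ → ℝ) (γ : ℝ) : Formula → ℕ → ℝ
  | ρ, t =>
    if t ≥ d then 1
    else
      match ρ with
      | .leq a b => smax γ (T t a - T t b) 0
      | .neq a b => sgauss γ (T t a - T t b)
      | .lt a b => smax γ (L d T γ (.leq a b) t) (L d T γ (.neq a b) t)
      | .eq a b => smax γ (L d T γ (.leq a b) t) (L d T γ (.leq b a) t)
      | .conj ρ₁ ρ₂ => smax γ (L d T γ ρ₁ t) (L d T γ ρ₂ t)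
      | .disj ρ₁ ρ₂ => smin γ (L d T γ ρ₁ t) (L d T γ ρ₂ t)
      | .snext ρ' => L d T γ ρ' (t+1)
      | .wnext ρ' => if t = d - 1 then 0 else L d T γ ρ' (t+1)
      | .always ρ' =>
          smax γ (L d T γ ρ' t)
            (if t = d - 1 then 0 else L d T γ (.always ρ') (t+1))
      | .eventually ρ' => smin γ (L d T γ ρ' t) (L d T γ (.eventually ρ') (t+1))
      | .wuntil ρ₁ ρ₂ =>
          smin γ (L d T γ ρ₂ t)
            (smax γ (L d T γ ρ₁ t)
              (if t = d - 1 then 0 else L d T γ (.wuntil ρ₁ ρ₂) (t+1)))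
      | .srelease ρ₁ ρ₂ =>
          smin γ (smax γ (L d T γ ρ₁ t) (L d T γ ρ₂ t))
            (smax γ (L d T γ ρ₂ t) (L d T γ (.srelease ρ₁ ρ₂) (t+1)))
termination_by ρ t => (d - t, ρ.weight)
decreasing_by all_goals
  (first
    | exact Prod.Lex.left _ _ (by omega)
    | exact Prod.Lex.right _ (by simp [Formula.weight] <;> omega))

theorem smax_assoc (γ a b c : ℝ) : smax γ (smax γ a b) c = smax γ a (smax γ b c) := by
  unfold smax
  split_ifs with h
  · exact max_assoc a b c
  · have hγ : γ ≠ 0 := (lt_of_not_ge h).ne'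
    rw [mul_div_cancel_left₀ _ hγ, mul_div_cancel_left₀ _ hγ,
      Real.exp_log (by positivity), Real.exp_log (by positivity), add_assoc]

theorem smin_eq_neg_smax_neg (γ a b : ℝ) : smin γ a b = -smax γ (-a) (-b) := by
  unfold smin smax
  split_ifs with h
  · rw [max_neg_neg, neg_neg]
  · rw [neg_mul]

theorem smin_assoc (γ a b c : ℝ) : smin γ (smin γ a b) c = smin γ a (smin γ b c) := by
  simp only [smin_eq_neg_smax_neg, neg_neg, smax_assoc]

theorem L_of_le {d t : ℕ} (h : d ≤ t) (T : ℕ → ℕ → ℝ) (γ : ℝ) (ρ : Formula) :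
    L d T γ ρ t = 1 := by
  rw [L.eq_def]
  exact if_pos h

theorem L_conj {d t : ℕ} (h : t < d) (T : ℕ → ℕ → ℝ) (γ : ℝ) (ρ₁ ρ₂ : Formula) :
    L d T γ (ρ₁.conj ρ₂) t = smax γ (L d T γ ρ₁ t) (L d T γ ρ₂ t) := by
  rw [L, if_neg h.not_ge]

theorem L_disj {d t : ℕ} (h : t < d) (T : ℕ → ℕ → ℝ) (γ : ℝ) (ρ₁ ρ₂ : Formula) :
    L d T γ (ρ₁.disj ρ₂) t = smin γ (L d T γ ρ₁ t) (L d T γ ρ₂ t) := by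
  rw [L, if_neg h.not_ge]

/-- Associativity of the loss. -/
theorem loss_assoc (ρ₁ ρ₂ ρ₃ : Formula) (d : ℕ) (T : ℕ → ℕ → ℝ) (t : ℕ)
    (γ : ℝ) :
    L d T γ (ρ₁.conj (ρ₂.conj ρ₃)) t = L d T γ ((ρ₁.conj ρ₂).conj ρ₃) t ∧
      L d T γ (ρ₁.disj (ρ₂.disj ρ₃)) t = L d T γ ((ρ₁.disj ρ₂).disj ρ₃) t := by
  rcases le_or_gt d t with h | h
  · simp only [L_of_le h, and_self]
  · simp only [L_conj h, L_disj h, smax_assoc, smin_assoc, and_self]
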